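/- arXiv:1907.04526 — 2 statements merged into one kernel-verified Lean document; each statement's English description precedes it below -/
import Mathlib

section
/- Let Ω ⊆ ℝ² be measurable with finite Lebesgue measure |Ω|, let τ > 0 and N ∈ ℕ. Let u₀, …, u_N : ℝ² → ℝ be differentiable with u_j and its gradient ∇u_j square-integrable on Ω, and let f₀, …, f_{N−1} : Ω → ℝ be measurable with 0 ≤ f_n(x) ≤ 1 for a.e. x ∈ Ω. Assume that for every 0 ≤ n ≤ N−1 the energy identity (1/τ)∫_Ω (u_{n+1} − u_n) u_{n+1} dx + ∫_Ω |∇u_{n+1}|² dx + ∫_Ω u_{n+1}² dx = ∫_Ω f_n u_{n+1} dx holds. Then for every 1 ≤ j ≤ N: ∫_Ω u_j² dx + Σ_{n=0}^{j−1} ∫_Ω (u_{n+1} − u_n)² dx + 2τ Σ_{n=0}^{j−1} ∫_Ω |∇u_{n+1}|² dx ≤ ∫_Ω u₀² dx + jτ |Ω|. -/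
open MeasureTheory

theorem two_mul_integral_sub_mul_self {α : Type*} [MeasurableSpace α] {μ : Measure α}
    {a b : α → ℝ} (ha : MemLp a 2 μ) (hb : MemLp b 2 μ) :
    2 * ∫ x, (a x - b x) * a x ∂μ =
      (∫ x, a x ^ 2 ∂μ) - (∫ x, b x ^ 2 ∂μ) + ∫ x, (a x - b x) ^ 2 ∂μ := by
  have hab : Integrable (fun x => (a x - b x) ^ 2) μ := (ha.sub hb).integrable_sq
  have hsq : Integrable (fun x => a x ^ 2 - b x ^ 2) μ := ha.integrable_sq.sub hb.integrable_sq
  rw [← integral_sub ha.integrable_sq hb.integrable_sq,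
    ← integral_add hsq hab, ← integral_const_mul]
  congr 1 with x
  ring

theorem integral_mul_le_integral_sq_add_half {α : Type*} [MeasurableSpace α] {μ : Measure α}
    [IsFiniteMeasure μ] {f a : α → ℝ} (hf : AEStronglyMeasurable f μ)
    (hbd : ∀ᵐ x ∂μ, 0 ≤ f x ∧ f x ≤ 1) (ha : MemLp a 2 μ) :
    ∫ x, f x * a x ∂μ ≤ (∫ x, a x ^ 2 ∂μ) + μ.real Set.univ / 2 := by
  have hfa : Integrable (fun x => f x * a x) μ := by
    refine (ha.integrable one_le_two).bdd_mul (c := 1) hf ?_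
    filter_upwards [hbd] with x hx
    rw [Real.norm_eq_abs, abs_of_nonneg hx.1]
    exact hx.2
  calc ∫ x, f x * a x ∂μ ≤ ∫ x, (a x ^ 2 + 1 / 2) ∂μ := by
        refine integral_mono_ae hfa (ha.integrable_sq.add (integrable_const _)) ?_
        filter_upwards [hbd] with x hx
        nlinarith [sq_nonneg (f x - a x), sq_nonneg (a x), hx.1, hx.2]
    _ = (∫ x, a x ^ 2 ∂μ) + μ.real Set.univ / 2 := by
        rw [integral_add ha.integrable_sq (integrable_const _), integral_const, smul_eq_mul]
        ring

theorem edge_variable_l2_apriori_estimate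
    (Ω : Set (EuclideanSpace ℝ (Fin 2))) (hΩmeas : MeasurableSet Ω)
    (hΩfin : volume Ω < ⊤)
    (τ : ℝ) (hτ : 0 < τ) (N : ℕ)
    (u : ℕ → EuclideanSpace ℝ (Fin 2) → ℝ)
    (hdiff : ∀ j ≤ N, Differentiable ℝ (u j))
    (hint : ∀ j ≤ N, IntegrableOn (fun x => (u j x) ^ 2) Ω volume ∧
      IntegrableOn (fun x => ‖gradient (u j) x‖ ^ 2) Ω volume)
    (f : ℕ → EuclideanSpace ℝ (Fin 2) → ℝ)
    (hfmeas : ∀ n < N, Measurable (f n))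
    (hfbd : ∀ n < N, ∀ᵐ x ∂(volume.restrict Ω), 0 ≤ f n x ∧ f n x ≤ 1)
    (hscheme : ∀ n < N,
      (1 / τ) * (∫ x in Ω, (u (n + 1) x - u n x) * u (n + 1) x) +
          (∫ x in Ω, ‖gradient (u (n + 1)) x‖ ^ 2) +
          (∫ x in Ω, (u (n + 1) x) ^ 2) =
        (∫ x in Ω, f n x * u (n + 1) x)) :
    ∀ j, 1 ≤ j → j ≤ N →
      (∫ x in Ω, (u j x) ^ 2) +
          (∑ n ∈ Finset.range j, (∫ x in Ω, (u (n + 1) x - u n x) ^ 2)) +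
          2 * τ * (∑ n ∈ Finset.range j, (∫ x in Ω, ‖gradient (u (n + 1)) x‖ ^ 2)) ≤
        (∫ x in Ω, (u 0 x) ^ 2) + (j : ℝ) * τ * (volume Ω).toReal := by
  have : IsFiniteMeasure (volume.restrict Ω) := ⟨by rwa [Measure.restrict_apply_univ]⟩
  have hL2 (j : ℕ) (hj : j ≤ N) : MemLp (u j) 2 (volume.restrict Ω) :=
    (memLp_two_iff_integrable_sq
      (hdiff j hj).continuous.measurable.aestronglyMeasurable).2 (hint j hj).1
  suffices h : ∀ j ≤ N, (∫ x in Ω, (u j x) ^ 2) +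
          (∑ n ∈ Finset.range j, (∫ x in Ω, (u (n + 1) x - u n x) ^ 2)) +
          2 * τ * (∑ n ∈ Finset.range j, (∫ x in Ω, ‖gradient (u (n + 1)) x‖ ^ 2)) ≤
        (∫ x in Ω, (u 0 x) ^ 2) + (j : ℝ) * τ * (volume Ω).toReal from
    fun j _ hj => h j hj
  intro j
  induction j with
  | zero => simp
  | succ n ih =>
    intro hn
    have hsub := two_mul_integral_sub_mul_self (hL2 (n + 1) hn) (hL2 n (by lia))
    have hsource := integral_mul_le_integral_sq_add_half
      (hfmeas n hn).aestronglyMeasurable (hfbd n hn) (hL2 (n + 1) hn)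
    rw [measureReal_restrict_apply_univ, ← hscheme n hn] at hsource
    have hstep := mul_le_mul_of_nonneg_left hsource (by positivity : 0 ≤ 2 * τ)
    have hcancel (z : ℝ) : τ * (1 / τ * z) = z := by field_simp
    have := hcancel (∫ x in Ω, (u (n + 1) x - u n x) * u (n + 1) x)
    rw [Finset.sum_range_succ, Finset.sum_range_succ]
    push_cast
    rw [Measure.real] at hstep
    linarith [ih (by lia)]
end

section
/- Let Ω ⊆ ℝ² be measurable, τ > 0, N ∈ ℕ, and C_P > 0. Let v₀, …, v_N : ℝ² → ℝ be differentiable with v_j and ∇v_j square-integrable on Ω, let I₀ and I_n (0 ≤ n ≤ N−1) be square-integrable on Ω, and assume the Poincaré inequality ∫_Ω v_{n+1}² dx ≤ C_P² ∫_Ω |∇v_{n+1}|² dx for each n. Assume that for every 0 ≤ n ≤ N−1 the identity (1/τ)∫_Ω (v_{n+1} − v_n) v_{n+1} dx + ∫_Ω |∇v_{n+1}|² dx = −∫_Ω (I₀ − I_n) v_{n+1} dx holds. Then for every 1 ≤ j ≤ N: ∫_Ω v_j² dx + Σ_{n=0}^{j−1} ∫_Ω (v_{n+1} − v_n)² dx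 + τ Σ_{n=0}^{j−1} ∫_Ω |∇v_{n+1}|² dx ≤ ∫_Ω v₀² dx + 2τ C_P² Σ_{n=0}^{j−1} (∫_Ω I₀² dx + ∫_Ω I_n² dx). -/
open MeasureTheory

section

variable {α : Type*} [MeasurableSpace α] {μ : Measure α}

/-- Polarization: `2 ∫ (f - g) f = ∫ f² - ∫ g² + ∫ (f - g)²` for square-integrable `f`, `g`. -/
theorem MeasureTheory.MemLp.two_mul_integral_sub_mul_self {f g : α → ℝ}
    (hf : MemLp f 2 μ) (hg : MemLp g 2 μ) :
    2 * ∫ x, (f x - g x) * f x ∂μ =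
      (∫ x, f x ^ 2 ∂μ) - (∫ x, g x ^ 2 ∂μ) + ∫ x, (f x - g x) ^ 2 ∂μ := by
  have hfg : Integrable (fun x => (f x - g x) ^ 2) μ := (hf.sub hg).integrable_sq
  have hsub : Integrable (fun x => f x ^ 2 - g x ^ 2) μ := hf.integrable_sq.sub hg.integrable_sq
  rw [← integral_sub hf.integrable_sq hg.integrable_sq,
    ← integral_add hsub hfg, ← integral_const_mul]
  congr 1 with x
  ring

/-- Weighted Young inequality for `∫ (a - b) w`. Measurability of `a` and `b` is not needed: if the
product is not integrable, the left-hand side vanishes. -/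
theorem neg_two_mul_integral_sub_mul_le {a b w : α → ℝ} {c : ℝ} (hc : 0 < c)
    (ha : Integrable (fun x => a x ^ 2) μ) (hb : Integrable (fun x => b x ^ 2) μ)
    (hw : Integrable (fun x => w x ^ 2) μ) :
    -(2 * ∫ x, (a x - b x) * w x ∂μ) ≤
      2 * c * ((∫ x, a x ^ 2 ∂μ) + ∫ x, b x ^ 2 ∂μ) + c⁻¹ * ∫ x, w x ^ 2 ∂μ := by
  have hab : Integrable (fun x => 2 * c * (a x ^ 2 + b x ^ 2)) μ := (ha.add hb).const_mul (2 * c)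
  rw [← integral_add ha hb, ← integral_const_mul (2 * c), ← integral_const_mul c⁻¹,
    ← integral_add hab (hw.const_mul c⁻¹), ← integral_const_mul, ← integral_neg]
  by_cases h : Integrable (fun x => -(2 * ((a x - b x) * w x))) μ
  · refine integral_mono h (hab.add (hw.const_mul c⁻¹)) fun x => ?_
    have key : 2 * c * (a x ^ 2 + b x ^ 2) + c⁻¹ * w x ^ 2 + 2 * ((a x - b x) * w x) =
        c * (a x + b x) ^ 2 + c⁻¹ * (c * (a x - b x) + w x) ^ 2 := by
      field_simp
      ring
    have hnonneg : 0 ≤ c * (a x + b x) ^ 2 + c⁻¹ * (c * (a x - b x) + w x) ^ 2 := by positivity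
    change -(2 * ((a x - b x) * w x)) ≤ 2 * c * (a x ^ 2 + b x ^ 2) + c⁻¹ * w x ^ 2
    linarith
  · rw [integral_undef h]
    exact integral_nonneg fun x => by positivity

end

theorem fidelity_variable_l2_apriori_estimate
    (Ω : Set (EuclideanSpace ℝ (Fin 2))) (hΩmeas : MeasurableSet Ω)
    (τ : ℝ) (hτ : 0 < τ) (N : ℕ) (C_P : ℝ) (hCP : 0 < C_P)
    (v : ℕ → EuclideanSpace ℝ (Fin 2) → ℝ)
    (hdiff : ∀ j ≤ N, Differentiable ℝ (v j))
    (hvint : ∀ j ≤ N, IntegrableOn (fun x => (v j x) ^ 2) Ω volume ∧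
      IntegrableOn (fun x => ‖gradient (v j) x‖ ^ 2) Ω volume)
    (I₀ : EuclideanSpace ℝ (Fin 2) → ℝ)
    (I : ℕ → EuclideanSpace ℝ (Fin 2) → ℝ)
    (hI₀int : IntegrableOn (fun x => (I₀ x) ^ 2) Ω volume)
    (hIint : ∀ n < N, IntegrableOn (fun x => (I n x) ^ 2) Ω volume)
    (hPoincare : ∀ n < N,
      (∫ x in Ω, (v (n + 1) x) ^ 2) ≤ C_P ^ 2 * (∫ x in Ω, ‖gradient (v (n + 1)) x‖ ^ 2))
    (hscheme : ∀ n < N,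
      (1 / τ) * (∫ x in Ω, (v (n + 1) x - v n x) * v (n + 1) x) +
          (∫ x in Ω, ‖gradient (v (n + 1)) x‖ ^ 2) =
        -(∫ x in Ω, (I₀ x - I n x) * v (n + 1) x)) :
    ∀ j, 1 ≤ j → j ≤ N →
      (∫ x in Ω, (v j x) ^ 2) +
          (∑ n ∈ Finset.range j, (∫ x in Ω, (v (n + 1) x - v n x) ^ 2)) +
          τ * (∑ n ∈ Finset.range j, (∫ x in Ω, ‖gradient (v (n + 1)) x‖ ^ 2)) ≤
        (∫ x in Ω, (v 0 x) ^ 2) +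
          2 * τ * C_P ^ 2 * (∑ n ∈ Finset.range j,
            ((∫ x in Ω, (I₀ x) ^ 2) + (∫ x in Ω, (I n x) ^ 2))) := by
  have hLp : ∀ j ≤ N, MemLp (v j) 2 (volume.restrict Ω) := fun j hj =>
    (memLp_two_iff_integrable_sq (hdiff j hj).continuous.aestronglyMeasurable).2 (hvint j hj).1
  have hstep : ∀ n < N,
      (∫ x in Ω, (v (n + 1) x) ^ 2) + (∫ x in Ω, (v (n + 1) x - v n x) ^ 2) +
          τ * (∫ x in Ω, ‖gradient (v (n + 1)) x‖ ^ 2) ≤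
        (∫ x in Ω, (v n x) ^ 2) +
          2 * τ * C_P ^ 2 * ((∫ x in Ω, (I₀ x) ^ 2) + (∫ x in Ω, (I n x) ^ 2)) := by
    intro n hn
    have hpol := (hLp (n + 1) hn).two_mul_integral_sub_mul_self (hLp n hn.le)
    have hyoung := neg_two_mul_integral_sub_mul_le (pow_pos hCP 2) hI₀int (hIint n hn)
      (hvint (n + 1) hn).1
    have hpoin := (inv_mul_le_iff₀ (pow_pos hCP 2)).2 (hPoincare n hn)
    have hsch := hscheme n hn
    rw [one_div, ← eq_sub_iff_add_eq, inv_mul_eq_iff_eq_mul₀ hτ.ne'] at hsch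
    have hτyoung := mul_le_mul_of_nonneg_left
      (hyoung.trans (add_le_add_right hpoin _)) hτ.le
    linarith
  rintro j -
  induction j with
  | zero => simp
  | succ k ih =>
    intro hk
    have hprev := ih (by omega)
    have hcur := hstep k hk
    simp only [Finset.sum_range_succ, mul_add] at hprev hcur ⊢
    linarith
end
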